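/- (Order N+2 for small p: positive part of the Proposition, comparison form.) Fix integers n ≥ 2, m ≥ 1, N ≥ 1 and let p ∈ (1, n). Then there exists a constant c > 0 such that for every φ ∈ C_c^∞(ℝ^(n+m)) and every word α ∈ {1,…,n+m}^(N+2) one has ‖Y^α φ‖_p ≤ c · max_{β} ‖X^β φ‖_p, where the maximum is over all words β of elements of 𝒳 with |β| = N+2. -/

import Mathlib

open MeasureTheory
open scoped ENNReal NNReal

/-- Points of `ℝ^(n+m)`, written `(x, y)` with `x ∈ ℝⁿ`, `y ∈ ℝᵐ`. -/
abbrev Pt (n m : ℕ) := (Fin n → ℝ) × (Fin m → ℝ)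

/-- The partial derivative operator `∂_{x_j}`. -/
noncomputable def Dx (n m : ℕ) (j : Fin n) (f : Pt n m → ℝ) : Pt n m → ℝ :=
  fun z => fderiv ℝ f z (Pi.single j 1, 0)

/-- The partial derivative operator `∂_{y_k}`. -/
noncomputable def Dy (n m : ℕ) (k : Fin m) (f : Pt n m → ℝ) : Pt n m → ℝ :=
  fun z => fderiv ℝ f z (0, Pi.single k 1)

/-- Index set for the family `𝒳`: either `j ∈ {1,…,n}` (giving `X_j = ∂_{x_j}`) or a pair
of a multi-index `ν ∈ ℕⁿ` with `|ν| = N` and `k ∈ {1,…,m}` (giving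
`X_{ν,k} = (N!/ν!)^(1/2) x^ν ∂_{y_k}`). -/
def XIdx (n m N : ℕ) := Fin n ⊕ ({ν : Fin n → ℕ // ∑ i, ν i = N} × Fin m)

/-- The family `𝒳` of first-order operators `X_j = ∂_{x_j}` and
`X_{ν,k} = (N!/ν!)^(1/2) x^ν ∂_{y_k}` for `|ν| = N`. -/
noncomputable def Xop (n m N : ℕ) : XIdx n m N → (Pt n m → ℝ) → (Pt n m → ℝ)
  | Sum.inl j => Dx n m j
  | Sum.inr (ν, k) => fun f z =>
      Real.sqrt ((Nat.factorial N : ℝ) / ∏ i, (Nat.factorial (ν.1 i) : ℝ)) *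
        (∏ i, z.1 i ^ ν.1 i) * Dy n m k f z

/-- Composition `Z_1 ∘ Z_2 ∘ ⋯ ∘ Z_s` of a word of operators. -/
def compOps {n m : ℕ} (l : List ((Pt n m → ℝ) → (Pt n m → ℝ))) :
    (Pt n m → ℝ) → (Pt n m → ℝ) :=
  l.foldr (· ∘ ·) id

/-- `X^α` for a word `α` of elements of `𝒳`. -/
noncomputable def Xw {n m N M : ℕ} (α : Fin M → XIdx n m N) :
    (Pt n m → ℝ) → (Pt n m → ℝ) :=
  compOps (List.ofFn fun i => Xop n m N (α i))

/-- The Gru\v{s}in operator `H_N = −Δ_x − |x|^(2N) Δ_y`. -/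
noncomputable def grusin (n m N : ℕ) (f : Pt n m → ℝ) : Pt n m → ℝ :=
  fun z => -(∑ j, Dx n m j (Dx n m j f) z) -
    (∑ i, z.1 i ^ 2) ^ N * ∑ k, Dy n m k (Dy n m k f) z

/-- The operators `Y_j = ∂_{x_j}` for `j ≤ n` and `Y_{n+l} = |x|^N ∂_{y_l}` for `l ≤ m`. -/
noncomputable def Yop (n m N : ℕ) : (Fin n ⊕ Fin m) → (Pt n m → ℝ) → (Pt n m → ℝ)
  | Sum.inl j => Dx n m j
  | Sum.inr l => fun f z => Real.sqrt (∑ i, z.1 i ^ 2) ^ N * Dy n m l f z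

/-- `Y^α` for a word `α ∈ {1,…,n+m}^M`. -/
noncomputable def Yw {n m N M : ℕ} (α : Fin M → (Fin n ⊕ Fin m)) :
    (Pt n m → ℝ) → (Pt n m → ℝ) :=
  compOps (List.ofFn fun i => Yop n m N (α i))


section Operators

/-- The smooth functions on `ℝⁿ × ℝᵐ`. -/
def smoothFun (n m : ℕ) : Submodule ℝ (Pt n m → ℝ) where
  carrier := {f | ContDiff ℝ (⊤ : ℕ∞) f}
  add_mem' {f g} (hf : ContDiff ℝ (⊤ : ℕ∞) f) (hg : ContDiff ℝ (⊤ : ℕ∞) g) := hf.add hg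
  zero_mem' := (contDiff_const : ContDiff ℝ (⊤ : ℕ∞) fun _ : Pt n m => (0 : ℝ))
  smul_mem' _ f (hf : ContDiff ℝ (⊤ : ℕ∞) f) := contDiff_const.smul hf

variable {n m : ℕ}

lemma smoothFun_contDiff (f : smoothFun n m) : ContDiff ℝ (⊤ : ℕ∞) (f : Pt n m → ℝ) := f.2

lemma smoothFun_differentiable (f : smoothFun n m) : Differentiable ℝ (f : Pt n m → ℝ) :=
  (smoothFun_contDiff f).differentiable (by simp)

lemma smoothFun_continuous (f : smoothFun n m) : Continuous (f : Pt n m → ℝ) :=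
  (smoothFun_contDiff f).continuous

/-- The directional derivative in direction `v`, acting on smooth functions. -/
noncomputable def dirDeriv (v : Pt n m) : Module.End ℝ (smoothFun n m) where
  toFun f := ⟨fun z => fderiv ℝ (f : Pt n m → ℝ) z v,
    ((smoothFun_contDiff f).fderiv_right (m := ((⊤ : ℕ∞) : WithTop ℕ∞)) (by simp)).clm_apply contDiff_const⟩
  map_add' f g := by
    ext z
    simp [fderiv_add (smoothFun_differentiable f z) (smoothFun_differentiable g z)]
  map_smul' c f := by
    ext z
    simp [fderiv_const_smul (smoothFun_differentiable f z)]

/-- Multiplication by a smooth function. -/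
def mulOp (a : Pt n m → ℝ) (ha : ContDiff ℝ (⊤ : ℕ∞) a) : Module.End ℝ (smoothFun n m) where
  toFun f := ⟨fun z => a z * (f : Pt n m → ℝ) z, ha.mul (smoothFun_contDiff f)⟩
  map_add' f g := by
    ext z
    simp [mul_add]
  map_smul' c f := by
    ext z
    simp [mul_left_comm]

/-- `∂_{x_j}` as an operator on smooth functions. -/
noncomputable def dxOp (n m : ℕ) (j : Fin n) : Module.End ℝ (smoothFun n m) :=
  dirDeriv (Pi.single j 1, 0)

/-- `∂_{y_k}` as an operator on smooth functions. -/
noncomputable def dyOp (n m : ℕ) (k : Fin m) : Module.End ℝ (smoothFun n m) :=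
  dirDeriv (0, Pi.single k 1)

/-- Multiplication by the coordinate `x_i`. -/
def xMul (n m : ℕ) (i : Fin n) : Module.End ℝ (smoothFun n m) :=
  mulOp (fun z => z.1 i) (by fun_prop)

/-- The family `𝒳` acting on smooth functions. -/
noncomputable def xEnd (n m N : ℕ) : XIdx n m N → Module.End ℝ (smoothFun n m)
  | Sum.inl j => dxOp n m j
  | Sum.inr (ν, k) =>
      mulOp (fun z => Real.sqrt ((Nat.factorial N : ℝ) / ∏ i, (Nat.factorial (ν.1 i) : ℝ)) *
        (∏ i, z.1 i ^ ν.1 i)) (by fun_prop) * dyOp n m k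

@[simp]
lemma coe_dxOp (j : Fin n) (f : smoothFun n m) : (dxOp n m j f : Pt n m → ℝ) = Dx n m j f := rfl

@[simp]
lemma coe_dyOp (k : Fin m) (f : smoothFun n m) : (dyOp n m k f : Pt n m → ℝ) = Dy n m k f := rfl

lemma coe_xEnd {N : ℕ} (b : XIdx n m N) (f : smoothFun n m) :
    (xEnd n m N b f : Pt n m → ℝ) = Xop n m N b f := by
  rcases b with j | ⟨ν, k⟩ <;> rfl

lemma xMul_pow_apply (i : Fin n) (d : ℕ) (f : smoothFun n m) (z : Pt n m) :
    ((xMul n m i ^ d) f : Pt n m → ℝ) z = z.1 i ^ d * (f : Pt n m → ℝ) z := by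
  induction d with
  | zero => simp
  | succ d ih =>
    rw [pow_succ', Module.End.mul_apply]
    change z.1 i * ((xMul n m i ^ d) f : Pt n m → ℝ) z = _
    rw [ih]
    ring

lemma dirDeriv_mul_xMul (v : Pt n m) (i : Fin n) :
    dirDeriv v * xMul n m i = xMul n m i * dirDeriv v + v.1 i • 1 := by
  ext f z
  have h1 : HasFDerivAt (fun z : Pt n m => z.1 i)
      ((ContinuousLinearMap.proj (R := ℝ) (φ := fun _ : Fin n => ℝ) i).comp
        (ContinuousLinearMap.fst ℝ (Fin n → ℝ) (Fin m → ℝ))) z :=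
    ContinuousLinearMap.hasFDerivAt
      ((ContinuousLinearMap.proj (R := ℝ) (φ := fun _ : Fin n => ℝ) i).comp
        (ContinuousLinearMap.fst ℝ (Fin n → ℝ) (Fin m → ℝ)))
  have h2 := (h1.mul (smoothFun_differentiable f z).hasFDerivAt).fderiv
  change fderiv ℝ (fun z : Pt n m => z.1 i * (f : Pt n m → ℝ) z) z v =
    z.1 i * fderiv ℝ f z v + v.1 i * (f : Pt n m → ℝ) z
  change fderiv ℝ (fun z : Pt n m => z.1 i * (f : Pt n m → ℝ) z) z = _ at h2
  rw [h2]
  simp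
  ring

lemma mul_pow_succ_of_commutator {A : Type*} [Semiring A] [Algebra ℝ A] {a x : A} {c : ℝ}
    (h : a * x = x * a + c • 1) (d : ℕ) :
    a * x ^ (d + 1) = x ^ (d + 1) * a + ((d + 1) * c) • x ^ d := by
  induction d with
  | zero => simp [h]
  | succ d ih =>
    rw [pow_succ x (d + 1), ← mul_assoc, ih, add_mul, mul_assoc, h, mul_add, ← mul_assoc,
      smul_mul_assoc, ← pow_succ, ← pow_succ, mul_smul_comm, mul_one, add_assoc, ← add_smul]
    congr 2
    push_cast
    ring

lemma dxOp_mul_xMul_pow (j i : Fin n) (d : ℕ) :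
    dxOp n m j * xMul n m i ^ (d + 1) = xMul n m i ^ (d + 1) * dxOp n m j +
      ((d + 1) * (Pi.single j 1 : Fin n → ℝ) i) • xMul n m i ^ d :=
  mul_pow_succ_of_commutator (A := Module.End ℝ (smoothFun n m)) (dirDeriv_mul_xMul _ i) d

lemma xMul_pow_mul_dyOp (i : Fin n) (k : Fin m) (d : ℕ) :
    Commute (xMul n m i ^ d) (dyOp n m k) := by
  have h := dirDeriv_mul_xMul (n := n) (m := m) (0, Pi.single k 1) i
  simp only [Pi.zero_apply, zero_smul, add_zero] at h
  exact Commute.pow_left h.symm d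

lemma dirDeriv_mul_comm (v w : Pt n m) : dirDeriv v * dirDeriv w = dirDeriv w * dirDeriv v := by
  ext f z
  have hf : ContDiff ℝ 2 (f : Pt n m → ℝ) := (smoothFun_contDiff f).of_le (by norm_cast)
  have hsymm := hf.contDiffAt (x := z) |>.isSymmSndFDerivAt (by simp)
  have hd : DifferentiableAt ℝ (fderiv ℝ (f : Pt n m → ℝ)) z :=
    ((hf.fderiv_right (m := 1) (by norm_num)).differentiable (by simp)) z
  have key (u w : Pt n m) : fderiv ℝ (fun z => fderiv ℝ (f : Pt n m → ℝ) z w) z u =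
      fderiv ℝ (fderiv ℝ (f : Pt n m → ℝ)) z u w := by
    rw [fderiv_clm_apply hd (by fun_prop)]
    simp
  change fderiv ℝ (fun z => fderiv ℝ (f : Pt n m → ℝ) z w) z v =
    fderiv ℝ (fun z => fderiv ℝ (f : Pt n m → ℝ) z v) z w
  rw [key, key, hsymm.eq]

/-- The span of the first-order operators in `𝒳`. -/
noncomputable def xSpan (n m N : ℕ) : Submodule ℝ (Module.End ℝ (smoothFun n m)) :=
  Submodule.span ℝ (Set.range (xEnd n m N))

lemma dxOp_mem_xSpan (N : ℕ) (j : Fin n) : dxOp n m j ∈ xSpan n m N :=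
  Submodule.subset_span ⟨Sum.inl j, rfl⟩

lemma xMul_pow_mul_dyOp_mem_xSpan (N : ℕ) (i : Fin n) (k : Fin m) :
    xMul n m i ^ N * dyOp n m k ∈ xSpan n m N := by
  let b : XIdx n m N := Sum.inr (⟨Pi.single i N, by simp⟩, k)
  refine Submodule.subset_span ⟨b, ?_⟩
  ext f z
  rw [coe_xEnd, Module.End.mul_apply, xMul_pow_apply]
  have h1 : (∏ l, (Nat.factorial ((Pi.single i N : Fin n → ℕ) l) : ℝ)) = Nat.factorial N := by
    rw [Finset.prod_eq_single i]
    · simp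
    · intro b _ hb
      simp [hb]
    · simp
  have h2 : (∏ l, z.1 l ^ ((Pi.single i N : Fin n → ℕ) l)) = z.1 i ^ N := by
    rw [Finset.prod_eq_single i]
    · simp
    · intro b _ hb
      simp [hb]
    · simp
  have h3 : (Nat.factorial N : ℝ) ≠ 0 := by positivity
  simp [Xop, b, h1, h2, h3]

lemma xMul_pow_mul_dyOp_mem (N : ℕ) (i : Fin n) (k : Fin m) (r d : ℕ) (h : d + r = N) :
    xMul n m i ^ d * dyOp n m k ∈ xSpan n m N ^ (r + 1) := by
  induction r generalizing d with
  | zero =>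
    obtain rfl : d = N := by lia
    simpa using xMul_pow_mul_dyOp_mem_xSpan d i k
  | succ r ih =>
    have h1 := ih (d + 1) (by lia)
    have h2 := dxOp_mem_xSpan (n := n) (m := m) N i
    have h3 := Submodule.mul_mem_mul h2 h1
    rw [← pow_succ'] at h3
    have h4 := Submodule.mul_mem_mul h1 h2
    rw [← pow_succ] at h4
    have h5 := Submodule.add_mem _ (Submodule.smul_mem _ ((d + 1 : ℝ)⁻¹) h3)
      (Submodule.smul_mem _ (-(d + 1 : ℝ)⁻¹) h4)
    convert h5 using 1
    have hd : (d + 1 : ℝ) ≠ 0 := by positivity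
    have hc : dyOp n m k * dxOp n m i = dxOp n m i * dyOp n m k := dirDeriv_mul_comm _ _
    rw [mul_assoc (xMul n m i ^ (d + 1)), hc, ← mul_assoc, ← mul_assoc, dxOp_mul_xMul_pow,
      add_mul, smul_add, add_assoc, add_left_comm, ← add_smul]
    simp [hd, smul_smul]

/-- Compositions of `k` operators `∂_{x_j}` and `s` operators `∂_{y_l}`, in any order. -/
inductive IsPartial (n m : ℕ) : ℕ → ℕ → Module.End ℝ (smoothFun n m) → Prop
  | one : IsPartial n m 0 0 1
  | dx {k s : ℕ} {D : Module.End ℝ (smoothFun n m)} (j : Fin n) :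
      IsPartial n m k s D → IsPartial n m (k + 1) s (dxOp n m j * D)
  | dy {k s : ℕ} {D : Module.End ℝ (smoothFun n m)} (l : Fin m) :
      IsPartial n m k s D → IsPartial n m k (s + 1) (dyOp n m l * D)

lemma IsPartial.xMul_pow_mul_mem (N : ℕ) (i : Fin n) {k s : ℕ}
    {D : Module.End ℝ (smoothFun n m)} (hD : IsPartial n m k s D) (d M : ℕ)
    (hd : d ≤ N * s) (hM : k + (N + 1) * s = M + d) :
    xMul n m i ^ d * D ∈ xSpan n m N ^ M := by
  induction hD generalizing d M with
  | one =>
    obtain rfl : d = 0 := by lia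
    obtain rfl : M = 0 := by lia
    rw [pow_zero, pow_zero, one_mul]
    exact Submodule.one_le.mp le_rfl
  | @dx k s D j _ ih =>
    obtain ⟨M, rfl⟩ : ∃ M', M = M' + 1 := ⟨M - 1, by lia⟩
    have h1 := Submodule.mul_mem_mul (dxOp_mem_xSpan N j) (ih d M hd (by lia))
    rw [← pow_succ', ← mul_assoc] at h1
    rcases d with _ | d
    · simpa using h1
    · have h2 := ih d (M + 1) (by lia) (by lia)
      have h3 := Submodule.add_mem _ h1
        (Submodule.smul_mem _ (-((d + 1) * (Pi.single j 1 : Fin n → ℝ) i)) h2)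
      rw [dxOp_mul_xMul_pow, add_mul, smul_mul_assoc, mul_assoc, add_assoc, ← add_smul,
        add_neg_cancel, zero_smul, add_zero] at h3
      exact h3
  | @dy k s D l _ ih =>
    have hle : min d N ≤ N := min_le_right _ _
    have h1 := xMul_pow_mul_dyOp_mem (m := m) N i l (N - min d N) (min d N) (by lia)
    rw [mul_add, mul_one] at hd
    rw [mul_add, mul_one] at hM
    have h2 := ih (d - min d N) (M - (N - min d N + 1)) (by lia) (by lia)
    have h3 := Submodule.mul_mem_mul h1 h2
    rw [← pow_add, mul_assoc, ← mul_assoc (dyOp n m l), ← (xMul_pow_mul_dyOp i l _).eq, mul_assoc,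
      ← mul_assoc, ← pow_add] at h3
    have e1 : min d N + (d - min d N) = d := by lia
    have e2 : N - min d N + 1 + (M - (N - min d N + 1)) = M := by
      have : (N + 1) * s = N * s + s := by ring
      lia
    rwa [e1, e2] at h3

lemma IsPartial.hasCompactSupport {k s : ℕ} {D : Module.End ℝ (smoothFun n m)}
    (hD : IsPartial n m k s D) {φ : smoothFun n m}
    (hφ : HasCompactSupport (φ : Pt n m → ℝ)) : HasCompactSupport (D φ : Pt n m → ℝ) := by
  induction hD with
  | one => simpa using hφ
  | dx j _ ih => exact ih.fderiv_apply ℝ _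
  | dy l _ ih => exact ih.fderiv_apply ℝ _

end Operators

section WordEstimate

variable {n m N : ℕ}

lemma compOps_ofFn_xop (l : List (XIdx n m N)) (φ : smoothFun n m) :
    compOps (l.map (Xop n m N)) (φ : Pt n m → ℝ) = ((l.map (xEnd n m N)).prod φ : Pt n m → ℝ) := by
  induction l with
  | nil => simp [compOps]
  | cons b l ih =>
    rw [List.map_cons, List.map_cons, List.prod_cons, Module.End.mul_apply, coe_xEnd, ← ih]
    rfl

lemma coe_prod_xEnd {M : ℕ} (β : Fin M → XIdx n m N) (φ : smoothFun n m) :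
    ((List.ofFn fun i => xEnd n m N (β i)).prod φ : Pt n m → ℝ) = Xw β φ := by
  have h := compOps_ofFn_xop (List.ofFn β) φ
  rw [List.map_ofFn, List.map_ofFn] at h
  exact h.symm

lemma exists_eLpNorm_le_of_mem_xSpan_pow {M : ℕ} {p : ℝ≥0∞} (hp : 1 ≤ p)
    {G : Module.End ℝ (smoothFun n m)} (hG : G ∈ xSpan n m N ^ M) :
    ∃ C : ℝ≥0, ∀ φ : smoothFun n m, eLpNorm (G φ : Pt n m → ℝ) p volume ≤
      C * ⨆ β : Fin M → XIdx n m N, eLpNorm (Xw β φ) p volume := by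
  rw [xSpan, Submodule.span_pow] at hG
  induction hG using Submodule.span_induction with
  | mem G hG =>
    obtain ⟨f, rfl⟩ := Set.mem_pow.mp hG
    choose β hβ using fun i => (f i).2
    refine ⟨1, fun φ => ?_⟩
    simp_rw [← hβ, coe_prod_xEnd, ENNReal.coe_one, one_mul]
    exact le_iSup (fun β : Fin M → XIdx n m N => eLpNorm (Xw β φ) p volume) β
  | zero => exact ⟨0, fun φ => by simp⟩
  | add F G _ _ hF hG =>
    obtain ⟨C, hC⟩ := hF
    obtain ⟨C', hC'⟩ := hG
    refine ⟨C + C', fun φ => ?_⟩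
    rw [ENNReal.coe_add, add_mul]
    exact (eLpNorm_add_le (smoothFun_continuous _).aestronglyMeasurable
      (smoothFun_continuous _).aestronglyMeasurable hp).trans (add_le_add (hC φ) (hC' φ))
  | smul c F _ hF =>
    obtain ⟨C, hC⟩ := hF
    refine ⟨‖c‖₊ * C, fun φ => ?_⟩
    have h : ((c • F) φ : Pt n m → ℝ) = c • (F φ : Pt n m → ℝ) := rfl
    rw [h, eLpNorm_const_smul, ENNReal.coe_mul, mul_assoc]
    exact mul_le_mul_right (hC φ) _

end WordEstimate

section Homogeneous

variable {n : ℕ}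

/-- Functions that are smooth away from the origin and positively homogeneous of degree `d`. -/
structure IsHomog (d : ℤ) (a : (Fin n → ℝ) → ℝ) : Prop where
  contDiffOn : ContDiffOn ℝ (⊤ : ℕ∞) a {0}ᶜ
  map_smul : ∀ t : ℝ, 0 < t → ∀ x ≠ 0, a (t • x) = t ^ d * a x

lemma IsHomog.mul {d e : ℤ} {a b : (Fin n → ℝ) → ℝ} (ha : IsHomog d a) (hb : IsHomog e b) :
    IsHomog (d + e) (fun x => a x * b x) where
  contDiffOn := ha.contDiffOn.mul hb.contDiffOn
  map_smul t ht x hx := by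
    rw [ha.map_smul t ht x hx, hb.map_smul t ht x hx, zpow_add₀ ht.ne']
    ring

lemma IsHomog.fderiv {d : ℤ} {a : (Fin n → ℝ) → ℝ} (ha : IsHomog d a) (v : Fin n → ℝ) :
    IsHomog (d - 1) (fun x => fderiv ℝ a x v) where
  contDiffOn := (ha.contDiffOn.fderiv_of_isOpen isOpen_compl_singleton (by simp)).clm_apply
    contDiffOn_const
  map_smul t ht x hx := by
    have h1 : (fun x => a (t • x)) =ᶠ[nhds x] fun x => t ^ d * a x := by
      filter_upwards [isOpen_compl_singleton.mem_nhds hx] with y hy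
      exact ha.map_smul t ht y hy
    have hd : DifferentiableAt ℝ a x :=
      (ha.contDiffOn.differentiableOn (by simp)).differentiableAt
        (isOpen_compl_singleton.mem_nhds hx)
    have h2 := h1.fderiv_eq (𝕜 := ℝ)
    rw [fderiv_comp_smul (f := a) t, fderiv_const_mul hd] at h2
    have h3 := congrArg (fun L : (Fin n → ℝ) →L[ℝ] ℝ => L v) h2
    simp only [smul_apply, smul_eq_mul] at h3
    rw [zpow_sub_one₀ ht.ne']
    field_simp
    linarith

lemma isHomog_sqrt_sum_sq_pow (N : ℕ) :
    IsHomog (n := n) N (fun x => Real.sqrt (∑ i, x i ^ 2) ^ N) where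
  contDiffOn := by
    have h : ∀ x ∈ ({0}ᶜ : Set (Fin n → ℝ)), ∑ i, x i ^ 2 ≠ 0 := by
      refine fun x hx h => hx (funext fun i => ?_)
      simpa using (Finset.sum_eq_zero_iff_of_nonneg fun i _ => sq_nonneg (x i)).mp h i
        (Finset.mem_univ i)
    exact (ContDiffOn.sqrt (by fun_prop) h).pow N
  map_smul t ht x _ := by
    have : ∑ i, (t • x) i ^ 2 = t ^ 2 * ∑ i, x i ^ 2 := by
      simp [mul_pow, Finset.mul_sum]
    rw [this, Real.sqrt_mul (by positivity), Real.sqrt_sq ht.le, mul_pow, zpow_natCast]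

lemma IsHomog.exists_bound {d : ℤ} {a : (Fin n → ℝ) → ℝ} (ha : IsHomog d a) :
    ∃ C : ℝ≥0, ∀ x ≠ 0, |a x| ≤ C * ‖x‖ ^ d := by
  obtain ⟨C, hC⟩ := (isCompact_sphere (0 : Fin n → ℝ) 1).exists_bound_of_continuousOn
    (ha.contDiffOn.continuousOn.mono fun x hx h => by
      rw [Set.mem_singleton_iff] at h
      simp [h] at hx)
  refine ⟨C.toNNReal, fun x hx => ?_⟩
  have hx' : 0 < ‖x‖ := norm_pos_iff.mpr hx
  have h1 : ‖‖x‖⁻¹ • x‖ = 1 := by rw [norm_smul, norm_inv, norm_norm, inv_mul_cancel₀ hx'.ne']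
  have h2 := hC (‖x‖⁻¹ • x) (by simpa using h1)
  have h3 := ha.map_smul ‖x‖ hx' (‖x‖⁻¹ • x) (by rw [← norm_pos_iff, h1]; exact one_pos)
  rw [smul_smul, mul_inv_cancel₀ hx'.ne', one_smul] at h3
  rw [h3, abs_mul, abs_of_pos (zpow_pos hx' d), mul_comm]
  exact mul_le_mul_of_nonneg_right (h2.trans (Real.le_coe_toNNReal C)) (zpow_pos hx' d).le

end Homogeneous

section Hardy

variable {n m : ℕ}

lemma lintegral_smul_fst (h : Pt n m → ℝ≥0∞) (hh : Measurable h) {t : ℝ} (ht : 0 < t) :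
    ∫⁻ z : Pt n m, h (t • z.1, z.2) = ENNReal.ofReal (t ^ (-(n : ℝ))) * ∫⁻ z, h z := by
  have hm : Measurable fun z : Pt n m => h (t • z.1, z.2) := hh.comp (by fun_prop)
  rw [Measure.volume_eq_prod, lintegral_prod_symm' _ hm, lintegral_prod_symm' _ hh,
    ← lintegral_const_mul _ hh.lintegral_prod_left']
  congr 1
  ext y
  have h1 := lintegral_map (μ := (volume : Measure (Fin n → ℝ))) (f := fun x => h (x, y))
    (g := fun x => t • x) (hh.comp (by fun_prop)) (by fun_prop)
  rw [← h1, Measure.map_addHaar_smul _ ht.ne', lintegral_smul_measure, smul_eq_mul]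
  congr 2
  rw [abs_of_pos (by positivity), Module.finrank_fin_fun, Real.rpow_neg ht.le, Real.rpow_natCast]

/-- The averages `∫₁^∞ h(tx, y) dt` of Hardy type are bounded in `L_p` when `p < n`. -/
lemma exists_lintegral_average_le (n m : ℕ) {p : ℝ} (hp : 1 < p) (hpn : p < n) :
    ∃ C : ℝ≥0∞, C ≠ ⊤ ∧ ∀ h : Pt n m → ℝ≥0∞, Measurable h →
      ∫⁻ z : Pt n m, (∫⁻ t in Set.Ioi (1 : ℝ), h (t • z.1, z.2)) ^ p ≤ C * ∫⁻ z, h z ^ p := by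
  have hp0 : 0 < p := by linarith
  obtain ⟨a, ha1, ha2⟩ : ∃ a, p - 1 < a * p ∧ a * p < n - 1 :=
    ⟨((p - 1) + (n - 1)) / 2 / p, by rw [div_mul_cancel₀ _ hp0.ne']; linarith,
      by rw [div_mul_cancel₀ _ hp0.ne']; linarith⟩
  set q := p.conjExponent with hq
  have hpq : p.HolderConjugate q := Real.HolderConjugate.conjExponent hp
  have haq : -a * q < -1 := by
    have h1 : q * (p - 1) = p := by
      rw [hq, Real.conjExponent, div_mul_cancel₀]
      linarith
    have h2 : 0 < q := hpq.symm.pos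
    have h3 : q * (p - 1) < q * (a * p) := mul_lt_mul_of_pos_left ha1 h2
    rw [h1] at h3
    nlinarith
  have finite {c : ℝ} (hc : c < -1) : ∫⁻ t in Set.Ioi (1 : ℝ), ENNReal.ofReal (t ^ c) ≠ ⊤ := by
    have := (integrableOn_Ioi_rpow_of_lt hc one_pos).lintegral_lt_top
    exact this.ne
  set A := ∫⁻ t in Set.Ioi (1 : ℝ), ENNReal.ofReal (t ^ (-a * q)) with hA
  set B := ∫⁻ t in Set.Ioi (1 : ℝ), ENNReal.ofReal (t ^ (a * p - n)) with hB
  have hAt : A ≠ ⊤ := finite haq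
  have hBt : B ≠ ⊤ := finite (by linarith)
  refine ⟨A ^ (p / q) * B, ENNReal.mul_ne_top
    (ENNReal.rpow_ne_top_of_nonneg (div_nonneg hp0.le hpq.symm.pos.le) hAt) hBt, fun h hh => ?_⟩
  have holder (z : Pt n m) : (∫⁻ t in Set.Ioi (1 : ℝ), h (t • z.1, z.2)) ^ p ≤
      A ^ (p / q) * ∫⁻ t in Set.Ioi (1 : ℝ), ENNReal.ofReal (t ^ (a * p)) * h (t • z.1, z.2) ^ p := by
    have hz : Measurable fun t : ℝ => h (t • z.1, z.2) := hh.comp (by fun_prop)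
    have h1 := ENNReal.lintegral_mul_le_Lp_mul_Lq (volume.restrict (Set.Ioi (1 : ℝ))) hpq.symm
      (f := fun t => ENNReal.ofReal (t ^ (-a))) (g := fun t => ENNReal.ofReal (t ^ a) * h (t • z.1, z.2))
      (by fun_prop) (by fun_prop)
    have e1 : ∫⁻ t in Set.Ioi (1 : ℝ), h (t • z.1, z.2) = ∫⁻ t in Set.Ioi (1 : ℝ),
        ((fun t => ENNReal.ofReal (t ^ (-a))) *
          (fun t => ENNReal.ofReal (t ^ a) * h (t • z.1, z.2))) t := by
      refine setLIntegral_congr_fun measurableSet_Ioi fun t (ht : 1 < t) => ?_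
      have ht0 : 0 < t := by linarith
      rw [Pi.mul_apply, ← mul_assoc, ← ENNReal.ofReal_mul (by positivity), ← Real.rpow_add ht0]
      simp
    have e2 : ∫⁻ t in Set.Ioi (1 : ℝ), ENNReal.ofReal (t ^ (-a)) ^ q = A := by
      refine setLIntegral_congr_fun measurableSet_Ioi fun t (ht : 1 < t) => ?_
      have ht0 : 0 < t := by linarith
      rw [ENNReal.ofReal_rpow_of_pos (by positivity), ← Real.rpow_mul ht0.le]
    have e3 : ∫⁻ t in Set.Ioi (1 : ℝ), (ENNReal.ofReal (t ^ a) * h (t • z.1, z.2)) ^ p =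
        ∫⁻ t in Set.Ioi (1 : ℝ), ENNReal.ofReal (t ^ (a * p)) * h (t • z.1, z.2) ^ p := by
      refine setLIntegral_congr_fun measurableSet_Ioi fun t (ht : 1 < t) => ?_
      have ht0 : 0 < t := by linarith
      rw [ENNReal.mul_rpow_of_nonneg _ _ hp0.le, ENNReal.ofReal_rpow_of_pos (by positivity),
        ← Real.rpow_mul ht0.le]
    rw [← e1, e2, e3] at h1
    refine (ENNReal.rpow_le_rpow h1 hp0.le).trans_eq ?_
    rw [ENNReal.mul_rpow_of_nonneg _ _ hp0.le, ← ENNReal.rpow_mul, ← ENNReal.rpow_mul,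
      one_div_mul_cancel hp0.ne', ENNReal.rpow_one, one_div_mul_eq_div]
  calc ∫⁻ z : Pt n m, (∫⁻ t in Set.Ioi (1 : ℝ), h (t • z.1, z.2)) ^ p
      ≤ ∫⁻ z : Pt n m, A ^ (p / q) *
          ∫⁻ t in Set.Ioi (1 : ℝ), ENNReal.ofReal (t ^ (a * p)) * h (t • z.1, z.2) ^ p :=
        lintegral_mono holder
    _ = A ^ (p / q) * ∫⁻ z : Pt n m, ∫⁻ t in Set.Ioi (1 : ℝ),
          ENNReal.ofReal (t ^ (a * p)) * h (t • z.1, z.2) ^ p := by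
        rw [lintegral_const_mul]
        exact Measurable.lintegral_prod_right' (f := fun w : Pt n m × ℝ =>
          ENNReal.ofReal (w.2 ^ (a * p)) * h (w.2 • w.1.1, w.1.2) ^ p) (by fun_prop)
    _ = A ^ (p / q) * ∫⁻ t in Set.Ioi (1 : ℝ), ∫⁻ z : Pt n m,
          ENNReal.ofReal (t ^ (a * p)) * h (t • z.1, z.2) ^ p := by
        rw [lintegral_lintegral_swap]
        exact Measurable.aemeasurable (f := fun w : Pt n m × ℝ =>
          ENNReal.ofReal (w.2 ^ (a * p)) * h (w.2 • w.1.1, w.1.2) ^ p) (by fun_prop)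
    _ = A ^ (p / q) * ∫⁻ t in Set.Ioi (1 : ℝ),
          ENNReal.ofReal (t ^ (a * p - n)) * ∫⁻ z, h z ^ p := by
        congr 1
        refine setLIntegral_congr_fun measurableSet_Ioi fun t (ht : 1 < t) => ?_
        have ht0 : 0 < t := by linarith
        have hm : Measurable fun z : Pt n m => h (t • z.1, z.2) ^ p :=
          (hh.comp (by fun_prop)).pow_const p
        rw [lintegral_const_mul _ hm, lintegral_smul_fst (fun z => h z ^ p) (hh.pow_const p) ht0,
          ← mul_assoc, ← ENNReal.ofReal_mul (by positivity), ← Real.rpow_add ht0, sub_eq_add_neg]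
    _ = A ^ (p / q) * B * ∫⁻ z, h z ^ p := by
        rw [lintegral_mul_const _ (by fun_prop), ← mul_assoc]

lemma enorm_le_lintegral_Ioi_deriv {g : ℝ → ℝ} (hg : ContDiff ℝ 1 g) (hc : HasCompactSupport g)
    (x : ℝ) : ‖g x‖ₑ ≤ ∫⁻ t in Set.Ioi x, ‖deriv g t‖ₑ := by
  have h := HasCompactSupport.enorm_le_lintegral_Ici_deriv (f := fun t => g (-t))
    (hg.comp contDiff_neg) (hc.comp_homeomorph (Homeomorph.neg ℝ)) (-x)
  simp only [neg_neg] at h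
  refine h.trans_eq ?_
  have e (y : ℝ) : ‖deriv (fun t => g (-t)) y‖ₑ = ‖deriv g (-y)‖ₑ := by
    rw [deriv_comp_neg, enorm_neg]
  simp_rw [e]
  rw [← (Measure.measurePreserving_neg (volume : Measure ℝ)).setLIntegral_comp_preimage_emb
    (MeasurableEquiv.neg ℝ).measurableEmbedding (fun t => ‖deriv g t‖ₑ) (Set.Ioi x),
    ← restrict_Iio_eq_restrict_Iic]
  congr 2
  ext t
  simp

lemma fderiv_fst_eq_sum {f : Pt n m → ℝ} (z : Pt n m) (x : Fin n → ℝ) :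
    fderiv ℝ f z (x, 0) = ∑ j, x j * Dx n m j f z := by
  have h : (x, (0 : Fin m → ℝ)) = ∑ j, x j • ((Pi.single j 1, 0) : Pt n m) := by
    ext i
    · simp [Prod.fst_sum, Finset.sum_apply, Pi.single_apply]
    · simp [Prod.snd_sum]
  rw [h, map_sum]
  simp only [map_smul, smul_eq_mul, Dx]

lemma enorm_le_mul_lintegral_Dx {f : Pt n m → ℝ} (hf : ContDiff ℝ 1 f)
    (hc : HasCompactSupport f) {z : Pt n m} (hz : z.1 ≠ 0) :
    ‖f z‖ₑ ≤ ‖z.1‖ₑ * ∫⁻ t in Set.Ioi (1 : ℝ), ∑ j, ‖Dx n m j f (t • z.1, z.2)‖ₑ := by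
  have hemb : Topology.IsClosedEmbedding fun t : ℝ => ((t • z.1, z.2) : Pt n m) := by
    have h1 := (isClosedEmbedding_smul_left (𝕜 := ℝ) hz)
    refine Topology.IsClosedEmbedding.of_continuous_injective_isClosedMap (by fun_prop)
      (fun s t h => h1.injective (congrArg Prod.fst h)) fun s hs => ?_
    have : (fun t : ℝ => ((t • z.1, z.2) : Pt n m)) '' s =
        ((fun t : ℝ => t • z.1) '' s) ×ˢ {z.2} := by
      ext w
      simp only [Set.mem_image, Set.mem_prod, Set.mem_singleton_iff, Prod.ext_iff]
      aesop
    rw [this]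
    exact (h1.isClosedMap s hs).prod isClosed_singleton
  have hder (t : ℝ) : deriv (fun t : ℝ => f (t • z.1, z.2)) t =
      ∑ j, z.1 j * Dx n m j f (t • z.1, z.2) := by
    rw [← fderiv_fst_eq_sum]
    have h1 : HasDerivAt (fun t : ℝ => ((t • z.1, z.2) : Pt n m)) (z.1, 0) t := by
      simpa using ((hasDerivAt_id t).smul_const z.1).prodMk (hasDerivAt_const t z.2)
    exact ((hf.differentiable (by simp) _).hasFDerivAt.comp_hasDerivAt t h1).deriv
  have h := enorm_le_lintegral_Ioi_deriv (g := fun t : ℝ => f (t • z.1, z.2))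
    (hf.comp (by fun_prop)) (hc.comp_isClosedEmbedding hemb) 1
  rw [one_smul] at h
  refine h.trans ?_
  rw [← lintegral_const_mul' _ _ enorm_ne_top]
  refine lintegral_mono fun t => ?_
  rw [hder, Finset.mul_sum]
  refine (enorm_sum_le _ _).trans (Finset.sum_le_sum fun j _ => ?_)
  rw [enorm_mul]
  gcongr
  exact enorm_le_iff_norm_le.mpr (norm_le_pi_norm _ _)

/-- Hardy's inequality in the variable `x ∈ ℝⁿ`, for `1 < p < n`. -/
lemma exists_hardy (n m : ℕ) {p : ℝ} (hp : 1 < p) (hpn : p < n) :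
    ∃ C : ℝ≥0, ∀ f : Pt n m → ℝ, ContDiff ℝ 1 f → HasCompactSupport f →
      eLpNorm (fun z => ‖z.1‖⁻¹ * f z) (ENNReal.ofReal p) volume ≤
        C * ∑ j, eLpNorm (Dx n m j f) (ENNReal.ofReal p) volume := by
  have hp0 : 0 < p := by linarith
  obtain ⟨C, hC, hle⟩ := exists_lintegral_average_le n m hp hpn
  refine ⟨(C ^ (1 / p)).toNNReal, fun f hf hc => ?_⟩
  have hcont (j : Fin n) : Continuous (Dx n m j f) :=
    (hf.continuous_fderiv (by simp)).clm_apply continuous_const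
  rw [ENNReal.coe_toNNReal (ENNReal.rpow_ne_top_of_nonneg (by positivity) hC)]
  have e {g : Pt n m → ℝ} : eLpNorm g (ENNReal.ofReal p) volume =
      (∫⁻ z, ‖g z‖ₑ ^ p) ^ (1 / p) := by
    rw [eLpNorm_eq_lintegral_rpow_enorm_toReal (by simpa using hp0) (by simp),
      ENNReal.toReal_ofReal hp0.le]
  have hsum : (∫⁻ z, (∑ j, ‖Dx n m j f z‖ₑ) ^ p) ^ (1 / p) ≤
      ∑ j, eLpNorm (Dx n m j f) (ENNReal.ofReal p) volume := by
    have h1 : eLpNorm (∑ j, fun z => ‖Dx n m j f z‖) (ENNReal.ofReal p) volume ≤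
        ∑ j, eLpNorm (fun z => ‖Dx n m j f z‖) (ENNReal.ofReal p) volume :=
      eLpNorm_sum_le (fun j _ => (hcont j).norm.aestronglyMeasurable)
        (by simpa using ENNReal.ofReal_le_ofReal hp.le)
    simp only [eLpNorm_norm] at h1
    rw [e] at h1
    convert h1 using 5 with z
    rw [Finset.sum_apply, Real.enorm_of_nonneg (by positivity),
      ENNReal.ofReal_sum_of_nonneg fun _ _ => norm_nonneg _]
    simp [Real.enorm_eq_ofReal_abs]
  have hpt (z : Pt n m) : ‖‖z.1‖⁻¹ * f z‖ₑ ≤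
      ∫⁻ t in Set.Ioi (1 : ℝ), ∑ j, ‖Dx n m j f (t • z.1, z.2)‖ₑ := by
    rcases eq_or_ne z.1 0 with hz | hz
    · simp [hz]
    · have hz' : ‖z.1‖ₑ ≠ 0 := by simpa using hz
      rw [enorm_mul, enorm_inv (by simpa using hz), enorm_norm]
      refine (mul_le_mul_right (enorm_le_mul_lintegral_Dx hf hc hz) _).trans_eq ?_
      rw [← mul_assoc, ENNReal.inv_mul_cancel hz' enorm_ne_top, one_mul]
  calc eLpNorm (fun z => ‖z.1‖⁻¹ * f z) (ENNReal.ofReal p) volume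
      = (∫⁻ z : Pt n m, ‖‖z.1‖⁻¹ * f z‖ₑ ^ p) ^ (1 / p) := e
    _ ≤ (C * ∫⁻ z, (∑ j, ‖Dx n m j f z‖ₑ) ^ p) ^ (1 / p) := by
        gcongr
        refine (lintegral_mono fun z => ENNReal.rpow_le_rpow (hpt z) hp0.le).trans ?_
        exact hle (fun z => ∑ j, ‖Dx n m j f z‖ₑ)
          (Finset.measurable_sum _ fun j _ => (hcont j).enorm.measurable)
    _ ≤ _ := by
        rw [ENNReal.mul_rpow_of_nonneg _ _ (by positivity)]
        gcongr

end Hardy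

section Expansion

variable {n m N : ℕ}

/-- The set `{x ≠ 0}`. -/
def offAxis (n m : ℕ) : Set (Pt n m) := {z | z.1 ≠ 0}

lemma isOpen_offAxis : IsOpen (offAxis n m) := isOpen_ne_fun continuous_fst continuous_const

lemma ae_mem_offAxis (hn : 1 ≤ n) : ∀ᵐ z : Pt n m, z ∈ offAxis n m := by
  have : Nonempty (Fin n) := ⟨⟨0, hn⟩⟩
  have h : (offAxis n m)ᶜ = ({0} : Set (Fin n → ℝ)) ×ˢ Set.univ := by
    ext z
    simp [offAxis]
  rw [ae_iff]
  change volume (offAxis n m)ᶜ = 0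
  rw [h, Measure.volume_eq_prod, Measure.prod_prod]
  simp

/-- Operators that on `{x ≠ 0}` are finite sums of terms `a(x) ∂_x^γ ∂_y^δ` of weight
`|γ| + (N + 1)|δ| - deg a = M`, where `a` is homogeneous of degree at most `N|δ|`, and `a`
is constant in the terms with `δ = 0`. -/
inductive HasExpansion (n m N : ℕ) : ℕ → (smoothFun n m → Pt n m → ℝ) → Prop
  | pure {k : ℕ} {D : Module.End ℝ (smoothFun n m)} :
      IsPartial n m k 0 D → HasExpansion n m N k (fun φ => (D φ : Pt n m → ℝ))
  | term {M k s : ℕ} {d : ℤ} {a : (Fin n → ℝ) → ℝ} {D : Module.End ℝ (smoothFun n m)} :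
      IsHomog d a → IsPartial n m k (s + 1) D → (k : ℤ) + (N + 1) * (s + 1) = M + d →
      d ≤ N * (s + 1) → HasExpansion n m N M (fun φ z => a z.1 * (D φ : Pt n m → ℝ) z)
  | add {M : ℕ} {F G : smoothFun n m → Pt n m → ℝ} :
      HasExpansion n m N M F → HasExpansion n m N M G →
      HasExpansion n m N M (fun φ z => F φ z + G φ z)
  | congr {M : ℕ} {F G : smoothFun n m → Pt n m → ℝ} :
      HasExpansion n m N M F → (∀ φ, Set.EqOn (F φ) (G φ) (offAxis n m)) →
      HasExpansion n m N M G

lemma IsHomog.contDiffOn_comp_fst {d : ℤ} {a : (Fin n → ℝ) → ℝ} (ha : IsHomog d a) :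
    ContDiffOn ℝ (⊤ : ℕ∞) (fun z : Pt n m => a z.1) (offAxis n m) :=
  ha.contDiffOn.comp contDiffOn_fst fun _ hz => hz

lemma HasExpansion.contDiffOn {M : ℕ} {F : smoothFun n m → Pt n m → ℝ}
    (hF : HasExpansion n m N M F) (φ : smoothFun n m) :
    ContDiffOn ℝ (⊤ : ℕ∞) (F φ) (offAxis n m) := by
  induction hF with
  | pure _ => exact (smoothFun_contDiff _).contDiffOn
  | term ha _ _ _ => exact ha.contDiffOn_comp_fst.mul (smoothFun_contDiff _).contDiffOn
  | add _ _ hF hG => exact hF.add hG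
  | congr _ h ih => exact ih.congr fun z hz => (h φ hz).symm

lemma HasExpansion.differentiableAt {M : ℕ} {F : smoothFun n m → Pt n m → ℝ}
    (hF : HasExpansion n m N M F) (φ : smoothFun n m) {z : Pt n m} (hz : z ∈ offAxis n m) :
    DifferentiableAt ℝ (F φ) z :=
  ((hF.contDiffOn φ).differentiableOn (by simp)).differentiableAt (isOpen_offAxis.mem_nhds hz)

lemma fderiv_fst_mul {d : ℤ} {a : (Fin n → ℝ) → ℝ} (ha : IsHomog d a) (f : smoothFun n m)
    {z : Pt n m} (hz : z ∈ offAxis n m) (v : Pt n m) :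
    fderiv ℝ (fun z : Pt n m => a z.1 * (f : Pt n m → ℝ) z) z v =
      fderiv ℝ a z.1 v.1 * (f : Pt n m → ℝ) z + a z.1 * fderiv ℝ (f : Pt n m → ℝ) z v := by
  have h1 : HasFDerivAt a (fderiv ℝ a z.1) z.1 :=
    ((ha.contDiffOn.differentiableOn (by simp)).differentiableAt
      (isOpen_compl_singleton.mem_nhds hz)).hasFDerivAt
  have h2 := (h1.comp z hasFDerivAt_fst).mul (smoothFun_differentiable f z).hasFDerivAt
  have h3 := h2.fderiv
  change fderiv ℝ (fun z : Pt n m => a z.1 * (f : Pt n m → ℝ) z) z = _ at h3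
  rw [h3]
  simp
  ring

lemma HasExpansion.dx {M : ℕ} {F : smoothFun n m → Pt n m → ℝ} (hF : HasExpansion n m N M F)
    (j : Fin n) : HasExpansion n m N (M + 1) (fun φ => Dx n m j (F φ)) := by
  induction hF with
  | pure hD => exact .pure (hD.dx j)
  | @term k s d a D ha hD h1 h2 =>
    refine .congr (.add (.term (ha.fderiv (Pi.single j 1)) hD (M := M + 1) ?_ ?_)
      (.term ha (hD.dx j) (M := M + 1) ?_ h2)) fun φ z hz =>
        (fderiv_fst_mul ha (D φ) hz (Pi.single j 1, 0)).symm
    all_goals push_cast; linarith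
  | add hF hG hF' hG' =>
    refine .congr (.add hF' hG') fun φ z hz => ?_
    simp only [Dx]
    rw [fderiv_fun_add (hF.differentiableAt φ hz) (hG.differentiableAt φ hz)]
    rfl
  | congr _ h ih =>
    refine .congr ih fun φ z hz => ?_
    simp only [Dx]
    rw [((h φ).eventuallyEq_of_mem (isOpen_offAxis.mem_nhds hz)).fderiv_eq]

lemma HasExpansion.sqrt_mul_dy {M : ℕ} {F : smoothFun n m → Pt n m → ℝ}
    (hF : HasExpansion n m N M F) (l : Fin m) :
    HasExpansion n m N (M + 1) (fun φ => Yop n m N (Sum.inr l) (F φ)) := by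
  induction hF with
  | @pure D hD =>
    refine .term (isHomog_sqrt_sum_sq_pow N) (hD.dy l) (M := M + 1) ?_ ?_
    all_goals push_cast; linarith
  | @term k s d a D ha hD h1 h2 =>
    refine .congr (.term ((isHomog_sqrt_sum_sq_pow N).mul ha) (hD.dy l) (M := M + 1) ?_ ?_)
      fun φ z hz => ?_
    · push_cast; linarith
    · push_cast; linarith
    · simp only [Yop, Dy]
      rw [fderiv_fst_mul ha _ hz]
      simp [Dy, mul_assoc]
  | add hF hG hF' hG' =>
    refine .congr (.add hF' hG') fun φ z hz => ?_
    simp only [Yop, Dy]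
    rw [fderiv_fun_add (hF.differentiableAt φ hz) (hG.differentiableAt φ hz), ← mul_add]
    rfl
  | congr _ h ih =>
    refine .congr ih fun φ z hz => ?_
    simp only [Yop, Dy]
    rw [((h φ).eventuallyEq_of_mem (isOpen_offAxis.mem_nhds hz)).fderiv_eq]

lemma hasExpansion_compOps (l : List (Fin n ⊕ Fin m)) :
    HasExpansion n m N l.length (fun φ => compOps (l.map (Yop n m N)) (φ : Pt n m → ℝ)) := by
  induction l with
  | nil => exact .pure (D := 1) .one
  | cons b l ih =>
    rcases b with j | l'
    · exact ih.dx j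
    · exact ih.sqrt_mul_dy l'

lemma hasExpansion_Yw {M : ℕ} (α : Fin M → (Fin n ⊕ Fin m)) :
    HasExpansion n m N M (fun φ => Yw (N := N) α (φ : Pt n m → ℝ)) := by
  have h := hasExpansion_compOps (N := N) (List.ofFn α)
  rw [List.length_ofFn, List.map_ofFn] at h
  exact h

lemma norm_pow_le_sum_abs_pow (hn : 1 ≤ n) (x : Fin n → ℝ) (d : ℕ) :
    ‖x‖ ^ d ≤ ∑ i, |x i| ^ d := by
  have : Nonempty (Fin n) := ⟨⟨0, hn⟩⟩
  obtain ⟨i, hi⟩ := Finite.exists_max fun i => |x i|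
  have h : ‖x‖ ≤ |x i| := (pi_norm_le_iff_of_nonneg (abs_nonneg _)).mpr hi
  exact (pow_le_pow_left₀ (norm_nonneg _) h d).trans
    (Finset.single_le_sum (f := fun i => |x i| ^ d) (fun _ _ => by positivity) (Finset.mem_univ i))

lemma eLpNorm_homog_mul_le (hn : 1 ≤ n) {p : ℝ≥0∞} (hp : 1 ≤ p) (d : ℕ) {a : (Fin n → ℝ) → ℝ}
    (ha : IsHomog d a) : ∃ C : ℝ≥0, ∀ f : smoothFun n m,
      eLpNorm (fun z => a z.1 * (f : Pt n m → ℝ) z) p volume ≤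
        C * ∑ i, eLpNorm ((xMul n m i ^ d) f : Pt n m → ℝ) p volume := by
  obtain ⟨C, hC⟩ := ha.exists_bound
  refine ⟨C, fun f => ?_⟩
  have h1 : eLpNorm (fun z => a z.1 * (f : Pt n m → ℝ) z) p volume ≤
      C * eLpNorm (∑ i, fun z => ‖((xMul n m i ^ d) f : Pt n m → ℝ) z‖) p volume := by
    refine eLpNorm_le_nnreal_smul_eLpNorm_of_ae_le_mul ?_ p
    filter_upwards [ae_mem_offAxis hn] with z hz
    rw [← NNReal.coe_le_coe, NNReal.coe_mul, coe_nnnorm, coe_nnnorm, norm_mul, Finset.sum_apply,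
      Real.norm_of_nonneg (Finset.sum_nonneg fun _ _ => norm_nonneg _)]
    simp only [xMul_pow_apply, norm_mul, norm_pow, ← Finset.sum_mul, ← mul_assoc]
    refine mul_le_mul_of_nonneg_right ((hC z.1 hz).trans ?_) (norm_nonneg _)
    exact mul_le_mul_of_nonneg_left (norm_pow_le_sum_abs_pow hn z.1 d) C.2
  refine h1.trans (mul_le_mul_right ((eLpNorm_sum_le (fun i _ =>
    (smoothFun_continuous _).norm.aestronglyMeasurable) hp).trans ?_) _)
  simp only [eLpNorm_norm]
  exact le_rfl

lemma HasExpansion.exists_bound (hn : 1 ≤ n) {p : ℝ} (hp : 1 < p) (hpn : p < n)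
    {F : smoothFun n m → Pt n m → ℝ} (hF : HasExpansion n m N (N + 2) F) :
    ∃ C : ℝ≥0, ∀ φ : smoothFun n m, HasCompactSupport (φ : Pt n m → ℝ) →
      eLpNorm (F φ) (ENNReal.ofReal p) volume ≤
        C * ⨆ β : Fin (N + 2) → XIdx n m N, eLpNorm (Xw β φ) (ENNReal.ofReal p) volume := by
  have hp' : 1 ≤ ENNReal.ofReal p := by simpa using ENNReal.ofReal_le_ofReal hp.le
  induction hF with
  | @pure D hD =>
    have h := hD.xMul_pow_mul_mem N ⟨0, hn⟩ 0 (N + 2) (by simp) (by simp)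
    rw [pow_zero, one_mul] at h
    obtain ⟨C, hC⟩ := exists_eLpNorm_le_of_mem_xSpan_pow hp' h
    exact ⟨C, fun φ _ => hC φ⟩
  | @term k s d a D ha hD h1 h2 =>
    rcases le_or_gt 0 d with hd | hd
    · lift d to ℕ using hd
      obtain ⟨C, hC⟩ := eLpNorm_homog_mul_le (m := m) hn hp' d ha
      choose C' hC' using fun i => exists_eLpNorm_le_of_mem_xSpan_pow hp'
        (hD.xMul_pow_mul_mem N i d (N + 2) (by exact_mod_cast h2) (by exact_mod_cast h1))
      refine ⟨C * ∑ i, C' i, fun φ _ => (hC (D φ)).trans ?_⟩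
      push_cast
      rw [mul_assoc, Finset.sum_mul]
      exact mul_le_mul_right (Finset.sum_le_sum fun i _ => hC' i φ) _
    · obtain rfl : s = 0 := by
        by_contra hs
        have : (1 : ℤ) ≤ s := by exact_mod_cast Nat.one_le_iff_ne_zero.mpr hs
        push_cast at h1
        nlinarith
      obtain rfl : k = 0 := by
        push_cast at h1
        lia
      obtain rfl : d = -1 := by
        push_cast at h1
        lia
      obtain ⟨C, hC⟩ := ha.exists_bound
      obtain ⟨K, hK⟩ := exists_hardy n m hp hpn
      choose C' hC' using fun j => exists_eLpNorm_le_of_mem_xSpan_pow hp'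
        ((hD.dx j).xMul_pow_mul_mem N ⟨0, hn⟩ 0 (N + 2) (by simp) (by lia))
      refine ⟨C * (K * ∑ j, C' j), fun φ hφ => ?_⟩
      have h3 := hK (D φ) ((smoothFun_contDiff _).of_le (by norm_cast))
        (hD.hasCompactSupport hφ)
      have h4 : eLpNorm (fun z => a z.1 * (D φ : Pt n m → ℝ) z) (ENNReal.ofReal p) volume ≤
          C * eLpNorm (fun z => ‖z.1‖⁻¹ * (D φ : Pt n m → ℝ) z) (ENNReal.ofReal p) volume := by
        refine eLpNorm_le_nnreal_smul_eLpNorm_of_ae_le_mul ?_ _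
        filter_upwards [ae_mem_offAxis hn] with z hz
        rw [← NNReal.coe_le_coe, NNReal.coe_mul, coe_nnnorm, coe_nnnorm, norm_mul, norm_mul,
          norm_inv, norm_norm, ← mul_assoc, ← zpow_neg_one]
        exact mul_le_mul_of_nonneg_right (hC z.1 hz) (norm_nonneg _)
      refine h4.trans ?_
      push_cast
      rw [mul_assoc, mul_assoc, Finset.sum_mul]
      refine mul_le_mul_right (h3.trans (mul_le_mul_right (Finset.sum_le_sum fun j _ => ?_) _)) _
      have h5 := hC' j φ
      rwa [pow_zero, one_mul] at h5
  | @add F G hF hG hF' hG' =>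
    obtain ⟨C, hC⟩ := hF'
    obtain ⟨C', hC'⟩ := hG'
    have meas {F : smoothFun n m → Pt n m → ℝ} (hF : HasExpansion n m N (N + 2) F) (φ : smoothFun n m) :
        AEStronglyMeasurable (F φ) := by
      have h := (hF.contDiffOn φ).continuousOn.aestronglyMeasurable (μ := volume)
        isOpen_offAxis.measurableSet
      rwa [Measure.restrict_eq_self_of_ae_mem (ae_mem_offAxis hn)] at h
    refine ⟨C + C', fun φ hφ => ?_⟩
    rw [ENNReal.coe_add, add_mul]
    exact (eLpNorm_add_le (meas hF φ) (meas hG φ) hp').trans (add_le_add (hC φ hφ) (hC' φ hφ))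
  | congr _ h ih =>
    obtain ⟨C, hC⟩ := ih
    refine ⟨C, fun φ hφ => ?_⟩
    rw [← eLpNorm_congr_ae ((ae_mem_offAxis hn).mono fun z hz => h φ hz)]
    exact hC φ hφ

end Expansion

/-- (Order `N+2` for small `p`: positive part of the Proposition,
comparison form.)  For `n ≥ 2`, `m, N ≥ 1` and `p ∈ (1, n)`, there is `c > 0` such that
`‖Y^α φ‖_p ≤ c · max_{|β| = N+2} ‖X^β φ‖_p` for all `φ ∈ C_c^∞(ℝ^(n+m))` and all words
`α ∈ {1,…,n+m}^(N+2)`. -/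
theorem Y_riesz_order_N_plus_two_small_p
    (n m N : ℕ) (hn : 2 ≤ n) (hm : 1 ≤ m) (hN : 1 ≤ N)
    (p : ℝ) (hp : 1 < p) (hpn : p < n) :
    ∃ c > (0 : ℝ), ∀ φ : Pt n m → ℝ, ContDiff ℝ (⊤ : ℕ∞) φ → HasCompactSupport φ →
      ∀ α : Fin (N + 2) → (Fin n ⊕ Fin m),
        eLpNorm (Yw (N := N) α φ) (ENNReal.ofReal p) volume ≤
          ENNReal.ofReal c *
            ⨆ β : Fin (N + 2) → XIdx n m N, eLpNorm (Xw β φ) (ENNReal.ofReal p) volume := by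
  have hn1 : 1 ≤ n := by lia
  choose C hC using fun α : Fin (N + 2) → (Fin n ⊕ Fin m) =>
    (hasExpansion_Yw (N := N) α).exists_bound hn1 hp hpn
  refine ⟨∑ α, (C α : ℝ) + 1, by positivity, fun φ hφ hc α => (hC α ⟨φ, hφ⟩ hc).trans ?_⟩
  refine mul_le_mul_left ?_ _
  rw [← ENNReal.ofReal_coe_nnreal]
  refine ENNReal.ofReal_le_ofReal ?_
  have := Finset.single_le_sum (f := fun α => (C α : ℝ)) (fun _ _ => NNReal.coe_nonneg _)
    (Finset.mem_univ α)
  linarith
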